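/- arXiv:1902.00992 — 2 statements merged into one kernel-verified Lean document; each statement's English description precedes it below -/
import Mathlib

section
/- Let (Ω,Σ,P) be a probability space and let K be a convex set of nonnegative random variables that is bounded in L^1(P). Assume K contains a countable subset S that is relatively internal in K, i.e., for every X ∈ K there exist Y ∈ S and t > 0 such that Y + t(Y − X) ∈ K. Then the following are equivalent: (1) for every X ∈ K, every forward convex combination of any sequence in K that converges to X in P-probability also converges to X in P-probability (the L^0(P)-topology is locally convex on K); (2) there exists a probability measure Q equivalent to P such that for every sequence (X_n) in K and every X ∈ K, (X_n) converges to X in P-probability if and only if E_Q[|X_n − X|] → 0. -/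
open MeasureTheory Filter Set ProbabilityTheory

noncomputable section

namespace Paper

variable {Ω : Type*} [MeasurableSpace Ω]

/-- The metric `d(X,Y) = E_P[min(|X - Y|, 1)]` metrizing convergence in `P`-probability. -/
def probDist (P : Measure Ω) (X Y : Ω → ℝ) : ℝ :=
  ∫ ω, min |X ω - Y ω| 1 ∂P

/-- `Q` is a probability measure equivalent to `P` (mutually absolutely continuous). -/
def EquivProb (P Q : Measure Ω) : Prop :=
  IsProbabilityMeasure Q ∧ Q ≪ P ∧ P ≪ Q

/-- `K` is a set of `P`-integrable random variables bounded in `L¹(P)`. -/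
def BddL1 (P : Measure Ω) (K : Set (Ω → ℝ)) : Prop :=
  (∀ X ∈ K, Integrable X P) ∧ ∃ C : ℝ, ∀ X ∈ K, (∫ ω, |X ω| ∂P) ≤ C

/-- `K` is `Q`-uniformly integrable: all members are `Q`-integrable and
`sup_{X ∈ K} E_Q[|X| · 1_{|X| > c}] → 0` as `c → ∞`. -/
def UIset (Q : Measure Ω) (K : Set (Ω → ℝ)) : Prop :=
  (∀ X ∈ K, Integrable X Q) ∧
  ∀ ε : ℝ, 0 < ε → ∃ c : ℝ, ∀ X ∈ K, (∫ ω in {ω | c < |X ω|}, |X ω| ∂Q) < ε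

/-- The sequence `Xs` is Cauchy in `P`-probability. -/
def CauchyInProb (P : Measure Ω) (Xs : ℕ → Ω → ℝ) : Prop :=
  ∀ ε : ℝ, 0 < ε →
    Tendsto (fun p : ℕ × ℕ => P {ω | ε ≤ |Xs p.1 ω - Xs p.2 ω|}) atTop (nhds 0)

/-- The (sequential) closure of `K` in the topology of convergence in `P`-probability. -/
def probClosure (P : Measure Ω) (K : Set (Ω → ℝ)) : Set (Ω → ℝ) :=
  {X | ∃ Xs : ℕ → Ω → ℝ, (∀ n, Xs n ∈ K) ∧ TendstoInMeasure P Xs atTop X}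

/-- A set `W` of random variables is solid: if `X ∈ W` and `|Y| ≤ |X|` a.s. then `Y ∈ W`. -/
def SolidSet (P : Measure Ω) (W : Set (Ω → ℝ)) : Prop :=
  ∀ X ∈ W, ∀ Y : Ω → ℝ, AEStronglyMeasurable Y P →
    (∀ᵐ ω ∂P, |Y ω| ≤ |X ω|) → Y ∈ W

/-- The solid hull of a set `A` of random variables. -/
def solidHull (P : Measure Ω) (A : Set (Ω → ℝ)) : Set (Ω → ℝ) :=
  {Y | AEStronglyMeasurable Y P ∧ ∃ X ∈ A, ∀ᵐ ω ∂P, |Y ω| ≤ |X ω|}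

/-- The relative `L⁰(P)`-topology on `K` is uniformly locally convex-solid on `S`:
for every `ε > 0` there is a convex solid set `W` of integrable random variables contained in the
`ε`-ball around `0` such that, for each `X ∈ S`, `(X + W) ∩ K` contains a `d`-ball of `K`
around `X`. -/
def UnifLCS (P : Measure Ω) (K S : Set (Ω → ℝ)) : Prop :=
  ∀ ε : ℝ, 0 < ε → ∃ W : Set (Ω → ℝ),
    (∀ Z ∈ W, Integrable Z P) ∧ Convex ℝ W ∧ SolidSet P W ∧
    (∀ Z ∈ W, probDist P Z 0 < ε) ∧
    ∀ X ∈ S, ∃ δ : ℝ, 0 < δ ∧ ∀ Z ∈ K, probDist P Z X < δ → Z - X ∈ W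

/-- The `L⁰(Q)`- and `L¹(Q)`-topologies agree on `K`: a sequence in `K` converges in
`P`-probability to a member of `K` iff it converges in `L¹(Q)`-norm. -/
def TopAgree (P Q : Measure Ω) (K : Set (Ω → ℝ)) : Prop :=
  ∀ (Xs : ℕ → Ω → ℝ) (X : Ω → ℝ), (∀ n, Xs n ∈ K) → X ∈ K →
    (TendstoInMeasure P Xs atTop X ↔
      Tendsto (fun n => ∫⁻ ω, ENNReal.ofReal |Xs n ω - X ω| ∂Q) atTop (nhds 0))

/-- `W` is a forward convex combination of the sequence `Z`. -/
def IsFCC (Z : ℕ → Ω → ℝ) (W : ℕ → Ω → ℝ) : Prop :=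
  ∀ k, W k ∈ convexHull ℝ (Z '' {n | k ≤ n})

/-- The relative `L⁰(P)`-topology on `K` is locally convex at `X` (forward convex combination
formulation): every FCC of a sequence in `K` converging to `X` in probability also converges
to `X` in probability. -/
def LocConvexAt (P : Measure Ω) (K : Set (Ω → ℝ)) (X : Ω → ℝ) : Prop :=
  ∀ Xs : ℕ → Ω → ℝ, (∀ n, Xs n ∈ K) → TendstoInMeasure P Xs atTop X →
    ∀ W : ℕ → Ω → ℝ, IsFCC Xs W → TendstoInMeasure P W atTop X

/-- The set `L = {Σ_k a_k R_k : Σ_k |a_k| ≤ 1}` (with pointwise a.e. absolutely convergent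
series, which also converge in `L¹(P)`). -/
def Lset (R : ℕ → Ω → ℝ) : Set (Ω → ℝ) :=
  {G | ∃ a : ℕ → ℝ, Summable (fun k => |a k|) ∧ (∑' k, |a k|) ≤ 1 ∧
    G = fun ω => ∑' k, a k * R k ω}

/-- The standard Cauchy distribution on `ℝ`. -/
def cauchyLaw : Measure ℝ :=
  MeasureTheory.volume.withDensity (fun t => ENNReal.ofReal (1 / (Real.pi * (1 + t ^ 2))))

/-- Local convexity of the relative topology on `A ⊆ E` at a point `x ∈ A`, in a topological
vector space. -/
def LocConvexAtTVS {E : Type*} [AddCommGroup E] [Module ℝ E] [TopologicalSpace E]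
    (A : Set E) (x : E) : Prop :=
  ∀ V ∈ nhds (0 : E), ∃ U ∈ nhds (0 : E), ∃ C : Set E,
    Convex ℝ C ∧ ((fun u => x + u) '' U) ∩ A ⊆ C ∧ C ⊆ ((fun v => x + v) '' V) ∩ A

/-- A convex family of nonnegative integrable functions which is uniformly close to `0` in
probability is uniformly close to `0` in `L¹` after discounting by a density close to `1`. -/
theorem exists_density_of_convex (P : Measure Ω) [IsProbabilityMeasure P] {C : Set (Ω → ℝ)}
    (hC : Convex ℝ C) (hne : C.Nonempty) (hint : ∀ V ∈ C, Integrable V P)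
    (hpos : ∀ V ∈ C, 0 ≤ᵐ[P] V) {ε : ℝ} (hε : ∀ V ∈ C, ∫ ω, min (V ω) 1 ∂P ≤ ε) :
    ∃ g : Ω → ℝ, Measurable g ∧ (∀ ω, 0 ≤ g ω) ∧ (∀ ω, g ω ≤ 1) ∧
      ∫ ω, (1 - g ω) ^ 2 ∂P ≤ 2 * ε ∧ ∀ V ∈ C, ∫ ω, g ω * V ω ∂P ≤ ε := by
  let one : Lp ℝ 2 P := indicatorConstLp 2 MeasurableSet.univ (measure_ne_top P _) 1
  have one_ae : one =ᵐ[P] fun _ => (1 : ℝ) := by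
    filter_upwards [indicatorConstLp_coeFn (p := 2) (hs := MeasurableSet.univ)
      (hμs := measure_ne_top P _) (c := (1 : ℝ))] with ω h
    exact h.trans (by simp)
  have norm_one : ‖one‖ = 1 := by
    refine (norm_indicatorConstLp (by norm_num) (by norm_num)).trans ?_
    simp
  have inner_one (v : Lp ℝ 2 P) : inner ℝ one v = ∫ ω, v ω ∂P := by
    exact (L2.inner_indicatorConstLp_one MeasurableSet.univ (measure_ne_top P _) v).trans
      (by rw [setIntegral_univ])
  let D : Set (Lp ℝ 2 P) := {u | ∃ V ∈ C, ∀ᵐ ω ∂P, 1 - V ω ≤ u ω}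
  have one_mem : one ∈ D := by
    obtain ⟨V, hV⟩ := hne
    refine ⟨V, hV, ?_⟩
    filter_upwards [one_ae, hpos V hV] with ω h1 h2
    rw [h1]
    simpa using h2
  have hD : Convex ℝ D := by
    rintro u ⟨V, hV, hu⟩ v ⟨W, hW, hv⟩ a b ha hb hab
    refine ⟨a • V + b • W, hC hV hW ha hb hab, ?_⟩
    filter_upwards [hu, hv, Lp.coeFn_add (a • u) (b • v), Lp.coeFn_smul a u,
      Lp.coeFn_smul b v] with ω h1 h2 h3 h4 h5
    rw [h3, Pi.add_apply (a • u : Lp ℝ 2 P), h4, h5]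
    simp only [Pi.add_apply, Pi.smul_apply, smul_eq_mul]
    nlinarith [mul_le_mul_of_nonneg_left h1 ha, mul_le_mul_of_nonneg_left h2 hb]
  have hDc : Convex ℝ (closure D) := hD.closure
  obtain ⟨u, huD, hu⟩ := exists_norm_eq_iInf_of_complete_convex
    ⟨one, subset_closure one_mem⟩ isClosed_closure.isComplete hDc (0 : Lp ℝ 2 P)
  rw [norm_eq_iInf_iff_real_inner_le_zero hDc huD] at hu
  have var : ∀ w ∈ closure D, ‖u‖ ^ 2 ≤ inner ℝ w u := by
    intro w hw
    have := hu w hw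
    rw [zero_sub, inner_neg_left, inner_sub_right, real_inner_self_eq_norm_sq,
      real_inner_comm] at this
    linarith
  have hui : Integrable u P := (Lp.memLp u).integrable (by norm_num)
  have hu0 : 0 ≤ᵐ[P] u := by
    refine ae_nonneg_of_forall_setIntegral_nonneg hui fun s hs hμs => ?_
    have hmem : u + indicatorConstLp 2 hs hμs.ne 1 ∈ closure D := by
      refine map_mem_closure (f := fun v => v + indicatorConstLp 2 hs hμs.ne (1 : ℝ))
        (by fun_prop) huD ?_
      rintro v ⟨V, hV, hv⟩
      refine ⟨V, hV, ?_⟩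
      filter_upwards [hv, Lp.coeFn_add v (indicatorConstLp 2 hs hμs.ne (1 : ℝ)),
        indicatorConstLp_coeFn (p := 2) (hs := hs) (hμs := hμs.ne) (c := (1 : ℝ))] with ω h1 h2 h3
      rw [h2, Pi.add_apply, h3]
      have : 0 ≤ s.indicator (fun _ => (1 : ℝ)) ω := indicator_nonneg (fun _ _ => zero_le_one) ω
      linarith
    have := var _ hmem
    rw [inner_add_left, real_inner_self_eq_norm_sq, L2.inner_indicatorConstLp_one] at this
    linarith
  have hNint : ‖u‖ ^ 2 ≤ ∫ ω, u ω ∂P := by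
    rw [← inner_one]; exact var _ (subset_closure one_mem)
  have hintN : ∫ ω, u ω ∂P ≤ ‖u‖ := by
    rw [← inner_one]
    simpa [norm_one] using real_inner_le_norm one u
  have hN1 : ‖u‖ ≤ 1 := by
    nlinarith [norm_nonneg u]
  have hNε : 1 - ε ≤ ‖u‖ := by
    refine closure_minimal (s := D) (t := {w | 1 - ε ≤ ‖w‖}) ?_
      (isClosed_le continuous_const continuous_norm) huD
    rintro w ⟨V, hV, hw⟩
    have hmin : Integrable (fun ω => min (V ω) 1) P := (hint V hV).inf (integrable_const 1)
    have h1 : ∫ ω, (1 - min (V ω) 1) ∂P ≤ ∫ ω, |w| ω ∂P := by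
      refine integral_mono_ae ((integrable_const 1).sub hmin)
        ((Lp.memLp |w|).integrable (by norm_num)) ?_
      filter_upwards [hw, Lp.coeFn_abs w] with ω h1 h2
      rw [h2]
      rcases le_total (V ω) 1 with h | h
      · simpa [h] using h1.trans (le_abs_self _)
      · simp [h]
    have h2 : ∫ ω, |w| ω ∂P ≤ ‖w‖ := by
      rw [← inner_one]
      simpa [norm_one, norm_abs_eq_norm] using real_inner_le_norm one |w|
    rw [integral_sub (integrable_const 1) hmin] at h1
    simp only [integral_const, probReal_univ, one_smul] at h1
    have := hε V hV
    show 1 - ε ≤ ‖w‖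
    linarith
  have husq : Integrable (fun ω => (u ω) ^ 2) P := (Lp.memLp u).integrable_sq
  have husqN : ∫ ω, (u ω) ^ 2 ∂P = ‖u‖ ^ 2 := by
    rw [← real_inner_self_eq_norm_sq, L2.inner_def]
    simp [sq]
  have hum' : Measurable u := (Lp.stronglyMeasurable u).measurable
  refine ⟨fun ω => min (max (u ω) 0) 1, (hum'.max measurable_const).min measurable_const,
    fun ω => le_min (le_max_right _ _) zero_le_one, fun ω => min_le_right _ _, ?_, ?_⟩
  · have hsq : Integrable (fun ω => (1 - u ω) ^ 2) P := by
      have : (fun ω => (1 - u ω) ^ 2) = fun ω => 1 - 2 * u ω + u ω ^ 2 := by ext; ring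
      rw [this]
      exact ((integrable_const 1).sub (hui.const_mul 2)).add husq
    calc ∫ ω, (1 - min (max (u ω) 0) 1) ^ 2 ∂P ≤ ∫ ω, (1 - u ω) ^ 2 ∂P := by
          refine integral_mono_of_nonneg (ae_of_all _ fun ω => sq_nonneg _) hsq ?_
          filter_upwards [hu0] with ω h
          simp only [Pi.zero_apply] at h
          simp only [max_eq_left h]
          rcases le_total (u ω) 1 with h' | h'
          · simp [h']
          · simp [h', sq_nonneg]
      _ = 1 - 2 * ∫ ω, u ω ∂P + ‖u‖ ^ 2 := by
          have : (fun ω => (1 - u ω) ^ 2) = fun ω => 1 - 2 * u ω + u ω ^ 2 := by ext; ring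
          have hlin : Integrable (fun ω => 1 - 2 * u ω) P :=
            (integrable_const 1).sub (hui.const_mul 2)
          rw [this, integral_add hlin husq,
            integral_sub (integrable_const 1) (hui.const_mul 2), integral_const_mul, husqN]
          simp
      _ ≤ 2 * ε := by nlinarith [norm_nonneg u]
  · intro V hV
    have hVm := (hint V hV).aestronglyMeasurable
    have hbound (n : ℕ) : ∫ ω, min (max (u ω) 0) 1 * min (V ω) n ∂P ≤ ε := by
      have hmem : MemLp (fun ω => min (V ω) n) 2 P := by
        refine MemLp.of_bound (hVm.inf aestronglyMeasurable_const) n ?_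
        filter_upwards [hpos V hV] with ω h
        rw [Real.norm_of_nonneg (le_min h n.cast_nonneg)]
        exact min_le_right _ _
      have h1 : one - hmem.toLp _ ∈ D := by
        refine ⟨V, hV, ?_⟩
        filter_upwards [Lp.coeFn_sub one (hmem.toLp _), one_ae, hmem.coeFn_toLp] with ω h1 h2 h3
        rw [h1, Pi.sub_apply, h2, h3]
        linarith [min_le_left (V ω) n]
      have h2 := var _ (subset_closure h1)
      rw [inner_sub_left, inner_one] at h2
      have h3 : inner ℝ (hmem.toLp _) u = ∫ ω, u ω * min (V ω) n ∂P := by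
        rw [L2.inner_def]
        refine integral_congr_ae ?_
        filter_upwards [hmem.coeFn_toLp] with ω h
        simp [h]
      have h4 : ∫ ω, min (max (u ω) 0) 1 * min (V ω) n ∂P ≤ ∫ ω, u ω * min (V ω) n ∂P := by
        refine integral_mono_of_nonneg ?_ ((Lp.memLp u).integrable_mul hmem) ?_
        · filter_upwards [hpos V hV] with ω h
          exact mul_nonneg (le_min (le_max_right _ _) zero_le_one) (le_min h n.cast_nonneg)
        · filter_upwards [hpos V hV, hu0] with ω h h'
          refine mul_le_mul_of_nonneg_right ?_ (le_min h n.cast_nonneg)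
          exact (min_le_left _ _).trans (max_eq_left h').le
      rw [h3] at h2
      nlinarith [norm_nonneg u]
    refine le_of_tendsto' (tendsto_integral_of_dominated_convergence (fun ω => V ω) (fun n => ?_)
      (hint V hV) (fun n => ?_) ?_) hbound
    · exact ((hum'.max measurable_const).min measurable_const).aestronglyMeasurable.mul
        (hVm.inf aestronglyMeasurable_const)
    · filter_upwards [hpos V hV] with ω h
      have h1 : 0 ≤ min (max (u ω) 0) 1 := le_min (le_max_right _ _) zero_le_one
      have h2 : 0 ≤ min (V ω) n := le_min h n.cast_nonneg
      rw [Real.norm_of_nonneg (mul_nonneg h1 h2)]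
      exact (mul_le_of_le_one_left h2 (min_le_right _ _)).trans (min_le_left _ _)
    · refine ae_of_all _ fun ω => Tendsto.const_mul _ (tendsto_const_nhds.congr' ?_)
      filter_upwards [eventually_ge_atTop ⌈V ω⌉₊] with n hn
      exact (min_eq_left ((Nat.le_ceil _).trans (by exact_mod_cast hn))).symm
theorem exists_pos_le_add_pow (P : Measure Ω) [IsProbabilityMeasure P] {g : ℕ → Ω → ℝ}
    (hgm : ∀ n, Measurable (g n)) (hg0 : ∀ n ω, 0 ≤ g n ω) (hg1 : ∀ n ω, g n ω ≤ 1)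
    (hg : ∀ n, ∫ ω, (1 - g n ω) ^ 2 ∂P ≤ 2 * (1 / 2) ^ n) :
    ∃ G : Ω → ℝ, Measurable G ∧ (∀ ω, 0 ≤ G ω) ∧ (∀ ω, G ω ≤ 1) ∧ (∀ᵐ ω ∂P, 0 < G ω) ∧
      ∀ n ω, G ω ≤ g n ω + (1 / 2) ^ n := by
  have hbdd (ω : Ω) : BddBelow (range fun n => min 1 (g n ω + (1 / 2 : ℝ) ^ n)) := by
    refine ⟨0, ?_⟩
    rintro _ ⟨n, rfl⟩
    exact le_min zero_le_one (add_nonneg (hg0 n ω) (by positivity))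
  have hlim : ∀ᵐ ω ∂P, Tendsto (fun n => g n ω) atTop (nhds 1) := by
    have hint (n : ℕ) : Integrable (fun ω => (1 - g n ω) ^ 2) P := by
      refine Integrable.of_bound (by fun_prop) 1 (ae_of_all _ fun ω => ?_)
      rw [Real.norm_of_nonneg (sq_nonneg _)]
      nlinarith [hg0 n ω, hg1 n ω]
    have hfin : ∑' n, ∫⁻ ω, ENNReal.ofReal ((1 - g n ω) ^ 2) ∂P ≠ ⊤ := by
      have hle (n : ℕ) : ∫⁻ ω, ENNReal.ofReal ((1 - g n ω) ^ 2) ∂P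
          ≤ ENNReal.ofReal (2 * (1 / 2) ^ n) := by
        rw [← ofReal_integral_eq_lintegral_ofReal (hint n) (ae_of_all _ fun ω => sq_nonneg _)]
        exact ENNReal.ofReal_le_ofReal (hg n)
      exact ne_top_of_le_ne_top (summable_geometric_two.mul_left 2).tsum_ofReal_ne_top
        (ENNReal.tsum_le_tsum hle)
    rw [← lintegral_tsum (fun n => by fun_prop)] at hfin
    filter_upwards [ae_lt_top' (by fun_prop) hfin] with ω hω
    have h1 := ENNReal.tendsto_atTop_zero_of_tsum_ne_top hω.ne
    have h2 := (ENNReal.tendsto_toReal ENNReal.zero_ne_top).comp h1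
    have h3 : Tendsto (fun n => √((1 - g n ω) ^ 2)) atTop (nhds 0) := by
      have h4 : Tendsto (fun n => (1 - g n ω) ^ 2) atTop (nhds 0) := by
        refine h2.congr fun n => ?_
        simp [ENNReal.toReal_ofReal (sq_nonneg (1 - g n ω))]
      simpa using h4.sqrt
    have h5 : Tendsto (fun n => 1 - √((1 - g n ω) ^ 2)) atTop (nhds (1 - 0)) :=
      tendsto_const_nhds.sub h3
    rw [sub_zero] at h5
    refine h5.congr fun n => ?_
    rw [Real.sqrt_sq (sub_nonneg.2 (hg1 n ω))]
    ring
  refine ⟨fun ω => ⨅ n, min 1 (g n ω + (1 / 2) ^ n), Measurable.iInf fun n => by fun_prop,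
    fun ω => le_ciInf fun n => le_min zero_le_one (add_nonneg (hg0 n ω) (by positivity)),
    fun ω => (ciInf_le (hbdd ω) 0).trans (min_le_left _ _), ?_,
    fun n ω => (ciInf_le (hbdd ω) n).trans (min_le_right _ _)⟩
  filter_upwards [hlim] with ω hω
  obtain ⟨N, hN⟩ := eventually_atTop.1 (hω.eventually_const_le (show (1 / 2 : ℝ) < 1 by norm_num))
  have hpos : (0 : ℝ) < (1 / 2) ^ (N + 1) := by positivity
  refine hpos.trans_le (le_ciInf fun n => le_min (pow_le_one₀ (by norm_num) (by norm_num)) ?_)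
  rcases le_total N n with h | h
  · have h1 : (1 / 2 : ℝ) ^ (N + 1) ≤ 1 / 2 := by
      simpa using pow_le_pow_of_le_one (show (0 : ℝ) ≤ 1 / 2 by norm_num) (by norm_num)
        (Nat.le_add_left 1 N)
    have h2 : (0 : ℝ) ≤ (1 / 2) ^ n := by positivity
    linarith [hN n h]
  · have h1 : (1 / 2 : ℝ) ^ (N + 1) ≤ (1 / 2) ^ n :=
      pow_le_pow_of_le_one (by norm_num) (by norm_num) (by omega)
    linarith [hg0 n ω]

theorem probDist_nonneg (P : Measure Ω) (X Y : Ω → ℝ) : 0 ≤ probDist P X Y :=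
  integral_nonneg fun _ => le_min (abs_nonneg _) zero_le_one

theorem integrable_min_abs_sub_one {P : Measure Ω} [IsFiniteMeasure P] {X Y : Ω → ℝ}
    (hX : AEStronglyMeasurable X P) (hY : AEStronglyMeasurable Y P) :
    Integrable (fun ω => min |X ω - Y ω| 1) P := by
  refine Integrable.of_bound ((hX.sub hY).norm.inf aestronglyMeasurable_const) 1
    (ae_of_all _ fun ω => ?_)
  change ‖min |X ω - Y ω| 1‖ ≤ 1
  rw [Real.norm_of_nonneg (le_min (abs_nonneg _) zero_le_one)]
  exact min_le_right _ _

theorem tendstoInMeasure_iff_tendsto_probDist {P : Measure Ω} [IsProbabilityMeasure P]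
    {Xs : ℕ → Ω → ℝ} {X : Ω → ℝ} (hXs : ∀ n, AEStronglyMeasurable (Xs n) P)
    (hX : AEStronglyMeasurable X P) :
    TendstoInMeasure P Xs atTop X ↔ Tendsto (fun n => probDist P (Xs n) X) atTop (nhds 0) := by
  rw [tendstoInMeasure_iff_measureReal_norm]
  simp only [Real.norm_eq_abs]
  have hint (n : ℕ) := integrable_min_abs_sub_one (hXs n) hX
  constructor
  · intro h
    refine Metric.tendsto_atTop.2 fun ε hε => ?_
    obtain ⟨N, hN⟩ := eventually_atTop.1 ((h (ε / 2) (half_pos hε)).eventually_lt_const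
      (half_pos hε))
    refine ⟨N, fun n hn => ?_⟩
    rw [Real.dist_0_eq_abs, abs_of_nonneg (probDist_nonneg _ _ _)]
    set A := {ω | ε / 2 ≤ |Xs n ω - X ω|}
    have hA : NullMeasurableSet A P :=
      nullMeasurableSet_le aemeasurable_const ((hXs n).sub hX).norm.aemeasurable
    have hAint : Integrable (A.indicator fun _ => (1 : ℝ)) P :=
      (integrable_const (1 : ℝ)).indicator₀ hA
    calc probDist P (Xs n) X ≤ ∫ ω, (ε / 2 + A.indicator (fun _ => (1 : ℝ)) ω) ∂P := by
          refine integral_mono (hint n) ((integrable_const _).add hAint) fun ω => ?_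
          change min |Xs n ω - X ω| 1 ≤ ε / 2 + A.indicator (fun _ => (1 : ℝ)) ω
          by_cases hω : ω ∈ A
          · rw [indicator_of_mem hω]
            linarith [min_le_right |Xs n ω - X ω| 1]
          · rw [indicator_of_notMem hω]
            have : |Xs n ω - X ω| < ε / 2 := not_le.1 hω
            linarith [min_le_left |Xs n ω - X ω| 1]
      _ = ε / 2 + P.real A := by
          rw [integral_add (integrable_const _) hAint, integral_indicator₀ hA]
          simp
      _ < ε := by linarith [hN n hn]
  · intro h ε hε
    have hη : 0 < min ε 1 := lt_min hε one_pos
    have hbound (n : ℕ) : P.real {ω | ε ≤ |Xs n ω - X ω|} ≤ probDist P (Xs n) X / min ε 1 := by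
      rw [le_div_iff₀ hη, mul_comm]
      have h1 := mul_meas_ge_le_integral_of_nonneg
        (ae_of_all _ fun ω => le_min (abs_nonneg _) zero_le_one) (hint n) (min ε 1)
      refine le_trans (mul_le_mul_of_nonneg_left (measureReal_mono fun ω hω => ?_) hη.le) h1
      exact min_le_min_right 1 (mem_ofPred_eq ▸ hω)
    refine squeeze_zero (fun n => measureReal_nonneg) hbound ?_
    simpa using h.div_const (min ε 1)

/-- Nonnegative functions close in probability to an integrable `X` have a small shortfall
below `X` in mean. -/
theorem exists_pos_integral_shortfall_le (P : Measure Ω) [IsProbabilityMeasure P] {X : Ω → ℝ}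
    (hX : Integrable X P) {η : ℝ} (hη : 0 < η) :
    ∃ δ > 0, ∀ Z : Ω → ℝ, Integrable Z P → 0 ≤ᵐ[P] Z → probDist P Z X < δ →
      ∫ ω, max (X ω - Z ω) 0 ∂P ≤ η := by
  have hint (c : ℕ) : Integrable (fun ω => max (X ω - c) 0) P :=
    (hX.sub (integrable_const _)).sup (integrable_const 0)
  have hlim : Tendsto (fun c : ℕ => ∫ ω, max (X ω - c) 0 ∂P) atTop (nhds 0) := by
    suffices h : Tendsto (fun c : ℕ => ∫ ω, max (X ω - c) 0 ∂P) atTop (nhds (∫ _, (0 : ℝ) ∂P)) by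
      simpa using h
    refine tendsto_integral_of_dominated_convergence (fun ω => |X ω|)
      (fun c => (hint c).aestronglyMeasurable) hX.abs (fun c => ae_of_all _ fun ω => ?_)
      (ae_of_all _ fun ω => tendsto_const_nhds.congr' ?_)
    · rw [Real.norm_of_nonneg (le_max_right _ _)]
      exact max_le (by linarith [le_abs_self (X ω), Nat.cast_nonneg (α := ℝ) c]) (abs_nonneg _)
    · filter_upwards [eventually_ge_atTop ⌈X ω⌉₊] with c hc
      have : X ω ≤ c := (Nat.le_ceil _).trans (by exact_mod_cast hc)
      exact (max_eq_right (by linarith)).symm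
  obtain ⟨c, hc, hc1⟩ := ((hlim.eventually_lt_const (half_pos hη)).and
    (eventually_ge_atTop 1)).exists
  have hc1' : (1 : ℝ) ≤ c := by exact_mod_cast hc1
  refine ⟨η / (2 * c), by positivity, fun Z hZ hZ0 hd => ?_⟩
  have hmin := integrable_min_abs_sub_one hZ.aestronglyMeasurable hX.aestronglyMeasurable
  calc ∫ ω, max (X ω - Z ω) 0 ∂P
      ≤ ∫ ω, (c * min |Z ω - X ω| 1 + max (X ω - c) 0) ∂P := by
        refine integral_mono_of_nonneg (ae_of_all _ fun ω => le_max_right _ _)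
          ((hmin.const_mul _).add (hint c)) ?_
        filter_upwards [hZ0] with ω h0
        simp only [Pi.zero_apply] at h0
        have h1 : 0 ≤ c * min |Z ω - X ω| 1 :=
          mul_nonneg (by linarith) (le_min (abs_nonneg _) zero_le_one)
        have h2 := le_max_right (X ω - c) 0
        have h3 := le_max_left (X ω - c) 0
        refine max_le ?_ (by linarith)
        rcases le_total |Z ω - X ω| 1 with h | h
        · rw [min_eq_left h]
          nlinarith [neg_abs_le (Z ω - X ω), abs_nonneg (Z ω - X ω)]
        · rw [min_eq_right h]
          linarith
    _ = c * probDist P Z X + ∫ ω, max (X ω - c) 0 ∂P := by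
        rw [integral_add (hmin.const_mul _) (hint c), integral_const_mul, probDist]
    _ ≤ η := by
        have : probDist P Z X * (2 * c) < η := (lt_div_iff₀ (by positivity)).1 hd
        linarith

theorem exists_range_sum_of_mem_convexHull_image {E F : Type*} [AddCommGroup F] [Module ℝ F]
    {f : E → F} {A : Set E} {v : F} (hv : v ∈ convexHull ℝ (f '' A)) :
    ∃ (N : ℕ) (w : ℕ → ℝ) (z : ℕ → E), (∀ i, 0 ≤ w i) ∧ ∑ i ∈ Finset.range N, w i = 1 ∧
      (∀ i < N, z i ∈ A) ∧ ∑ i ∈ Finset.range N, w i • f (z i) = v := by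
  obtain ⟨ι, _, w, y, hw0, hw1, hy, rfl⟩ := mem_convexHull_iff_exists_fintype.1 hv
  choose z hzA hzy using hy
  let e := Fintype.equivFin ι
  have hne : Nonempty E := (convexHull_nonempty_iff.1 ⟨_, hv⟩).of_image.to_type
  refine ⟨Fintype.card ι, fun i => if h : i < Fintype.card ι then w (e.symm ⟨i, h⟩) else 0,
    fun i => if h : i < Fintype.card ι then z (e.symm ⟨i, h⟩) else hne.some, fun i => ?_, ?_,
    fun i h => ?_, ?_⟩
  · dsimp only
    split_ifs with h
    exacts [hw0 _, le_rfl]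
  · rw [Finset.sum_range, ← hw1]
    simpa using e.symm.sum_comp w
  · simpa [h] using hzA _
  · rw [Finset.sum_range]
    simpa [hzy] using e.symm.sum_comp fun i => w i • y i

/-- Local convexity at `X` forces the convex hulls of `|Z - X|`, for `Z` near `X`, to be small in
probability. -/
theorem exists_pos_integral_min_convexHull_le {P : Measure Ω} [IsProbabilityMeasure P]
    {K : Set (Ω → ℝ)} (hK : Convex ℝ K) (hint : ∀ Z ∈ K, Integrable Z P)
    (hpos : ∀ Z ∈ K, 0 ≤ᵐ[P] Z) {X : Ω → ℝ} (hX : X ∈ K) (hloc : LocConvexAt P K X)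
    {ε : ℝ} (hε : 0 < ε) :
    ∃ δ > 0, ∀ V ∈ convexHull ℝ ((fun Z : Ω → ℝ => fun ω => |Z ω - X ω|) ''
      {Z | Z ∈ K ∧ probDist P Z X < δ}), ∫ ω, min (V ω) 1 ∂P ≤ ε := by
  obtain ⟨δ₀, hδ₀, hshort⟩ := exists_pos_integral_shortfall_le P (hint X hX)
    (show 0 < ε / 4 by positivity)
  by_contra! hcon
  have hδ (m : ℕ) : 0 < min δ₀ (1 / ((m : ℝ) + 1)) := lt_min hδ₀ (by positivity)
  choose V hV hVε using fun m : ℕ => hcon _ (hδ m)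
  choose N w Z hw0 hw1 hZ hVeq using fun m : ℕ => exists_range_sum_of_mem_convexHull_image (hV m)
  have hdXX : probDist P X X = 0 := by simp [probDist]
  let Y (n : ℕ) : Ω → ℝ := if n.unpair.2 < N n.unpair.1 then Z n.unpair.1 n.unpair.2 else X
  have hY (n : ℕ) : Y n ∈ K := by
    dsimp only [Y]
    split_ifs with h
    exacts [(hZ _ _ h).1, hX]
  have hYlim : TendstoInMeasure P Y atTop X := by
    rw [tendstoInMeasure_iff_tendsto_probDist (fun n => (hint _ (hY n)).aestronglyMeasurable)
      (hint X hX).aestronglyMeasurable, ← Nat.cofinite_eq_atTop]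
    refine tendsto_order.2 ⟨fun a ha => Eventually.of_forall fun n =>
      ha.trans_le (probDist_nonneg _ _ _), fun η hη => ?_⟩
    obtain ⟨M, hM⟩ := exists_nat_one_div_lt hη
    have hfin : ((fun p : ℕ × ℕ => Nat.pair p.1 p.2) ''
        ⋃ m ∈ Finset.range M, {m} ×ˢ Set.Iio (N m)).Finite :=
      (Finset.finite_toSet _).biUnion (fun m _ => (finite_singleton m).prod (finite_Iio _))
        |>.image _
    refine hfin.subset fun n hn => ?_
    have hn' : ¬ probDist P (Y n) X < η := hn
    refine ⟨n.unpair, ?_, Nat.pair_unpair n⟩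
    by_cases h : n.unpair.2 < N n.unpair.1
    · have h1 : probDist P (Y n) X < 1 / ((n.unpair.1 : ℝ) + 1) := by
        simp only [Y, if_pos h]
        exact (hZ _ _ h).2.trans_le (min_le_right _ _)
      have h2 : n.unpair.1 < M := by
        by_contra! hle
        refine hn' (h1.trans (lt_of_le_of_lt ?_ hM))
        gcongr
      simpa [h2] using h
    · simp only [Y, if_neg h, hdXX] at hn'
      exact absurd hη hn'
  let W (m : ℕ) : Ω → ℝ := ∑ i ∈ Finset.range (N m), w m i • Z m i
  have hWK (m : ℕ) : W m ∈ K := hK.sum_mem (fun i _ => hw0 m i) (hw1 m)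
    fun i hi => (hZ m i (Finset.mem_range.1 hi)).1
  have hWY : IsFCC Y W := by
    intro m
    refine (convex_convexHull ℝ _).sum_mem (fun i _ => hw0 m i) (hw1 m) fun i hi =>
      subset_convexHull ℝ _ ⟨Nat.pair m i, Nat.left_le_pair m i, ?_⟩
    simp [Y, Finset.mem_range.1 hi]
  have hWlim := hloc Y hY hYlim W hWY
  rw [tendstoInMeasure_iff_tendsto_probDist (fun n => (hint _ (hWK n)).aestronglyMeasurable)
    (hint X hX).aestronglyMeasurable] at hWlim
  obtain ⟨m, hm⟩ := (hWlim.eventually_lt_const (half_pos hε)).exists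
  have hZint (i : ℕ) (hi : i ∈ Finset.range (N m)) :
      Integrable (fun ω => w m i * max (X ω - Z m i ω) 0) P :=
    (((hint X hX).sub (hint _ (hZ m i (Finset.mem_range.1 hi)).1)).sup
      (integrable_const 0)).const_mul _
  have hWint := integrable_min_abs_sub_one (hint _ (hWK m)).aestronglyMeasurable
    (hint X hX).aestronglyMeasurable
  have hsum : ∫ ω, ∑ i ∈ Finset.range (N m), w m i * max (X ω - Z m i ω) 0 ∂P ≤ ε / 4 := by
    rw [integral_finsetSum _ hZint, ← one_mul (ε / 4), ← hw1 m, Finset.sum_mul]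
    refine Finset.sum_le_sum fun i hi => ?_
    rw [integral_const_mul]
    obtain ⟨hZK, hZd⟩ := hZ m i (Finset.mem_range.1 hi)
    exact mul_le_mul_of_nonneg_left (hshort _ (hint _ hZK) (hpos _ hZK)
      (hZd.trans_le (min_le_left _ _))) (hw0 m i)
  have hle : ∫ ω, min (V m ω) 1 ∂P ≤ ∫ ω, (min |W m ω - X ω| 1 +
      2 * ∑ i ∈ Finset.range (N m), w m i * max (X ω - Z m i ω) 0) ∂P := by
    have hV (ω : Ω) : V m ω = ∑ i ∈ Finset.range (N m), w m i * |Z m i ω - X ω| := by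
      simp [← hVeq m]
    refine integral_mono_of_nonneg (ae_of_all _ fun ω => ?_)
      (hWint.add ((integrable_finsetSum _ hZint).const_mul 2)) (ae_of_all _ fun ω => ?_)
    · exact le_min ((Finset.sum_nonneg fun i _ => mul_nonneg (hw0 m i) (abs_nonneg _)).trans_eq
        (hV ω).symm) zero_le_one
    · have hs0 : 0 ≤ ∑ i ∈ Finset.range (N m), w m i * max (X ω - Z m i ω) 0 :=
        Finset.sum_nonneg fun i _ => mul_nonneg (hw0 m i) (le_max_right _ _)
      have hid : V m ω = (W m ω - X ω) +
          2 * ∑ i ∈ Finset.range (N m), w m i * max (X ω - Z m i ω) 0 := by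
        have hXω : X ω = ∑ i ∈ Finset.range (N m), w m i * X ω := by
          rw [← Finset.sum_mul, hw1, one_mul]
        have hWω : W m ω = ∑ i ∈ Finset.range (N m), w m i * Z m i ω := by simp [W]
        rw [hV, hWω, Finset.mul_sum]
        nth_rewrite 2 [hXω]
        rw [← Finset.sum_sub_distrib, ← Finset.sum_add_distrib]
        refine Finset.sum_congr rfl fun i _ => ?_
        rcases le_total (X ω) (Z m i ω) with h | h
        · rw [abs_of_nonneg (sub_nonneg.2 h), max_eq_right (sub_nonpos.2 h)]
          ring
        · rw [abs_of_nonpos (sub_nonpos.2 h), max_eq_left (sub_nonneg.2 h)]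
          ring
      change min (V m ω) 1 ≤ min |W m ω - X ω| 1 + _
      rcases le_total |W m ω - X ω| 1 with h | h
      · rw [min_eq_left h]
        linarith [min_le_left (V m ω) 1, le_abs_self (W m ω - X ω)]
      · rw [min_eq_right h]
        linarith [min_le_right (V m ω) 1]
  rw [integral_add hWint ((integrable_finsetSum _ hZint).const_mul 2), integral_const_mul] at hle
  have := hVε m
  rw [probDist] at hm
  linarith

theorem tendstoInMeasure_of_absolutelyContinuous {P Q : Measure Ω} [IsFiniteMeasure P]
    [IsFiniteMeasure Q] (hPQ : P ≪ Q) {Xs : ℕ → Ω → ℝ} {X : Ω → ℝ}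
    (hXs : ∀ n, AEStronglyMeasurable (Xs n) Q) (h : TendstoInMeasure Q Xs atTop X) :
    TendstoInMeasure P Xs atTop X := by
  rw [exists_seq_tendstoInMeasure_atTop_iff hXs] at h
  rw [exists_seq_tendstoInMeasure_atTop_iff fun n => (hXs n).mono_ac hPQ]
  intro ns hns
  obtain ⟨ns', hns', h'⟩ := h ns hns
  exact ⟨ns', hns', hPQ.ae_le h'⟩

theorem tendstoInMeasure_of_tendsto_lintegral_abs {P Q : Measure Ω} [IsFiniteMeasure P]
    (hQ : EquivProb P Q) {Xs : ℕ → Ω → ℝ} {X : Ω → ℝ}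
    (hXs : ∀ n, AEStronglyMeasurable (Xs n) P) (hX : AEStronglyMeasurable X P)
    (h : Tendsto (fun n => ∫⁻ ω, ENNReal.ofReal |Xs n ω - X ω| ∂Q) atTop (nhds 0)) :
    TendstoInMeasure P Xs atTop X := by
  obtain ⟨_, hQP, hPQ⟩ := hQ
  have hXsQ (n : ℕ) := (hXs n).mono_ac hQP
  refine tendstoInMeasure_of_absolutelyContinuous hPQ hXsQ
    (tendstoInMeasure_of_tendsto_eLpNorm one_ne_zero hXsQ (hX.mono_ac hQP) ?_)
  simpa [eLpNorm_one_eq_lintegral_enorm, Real.enorm_eq_ofReal_abs] using h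

theorem exists_equivProb_lintegral_eq (P : Measure Ω) [IsProbabilityMeasure P] {G : Ω → ℝ}
    (hGm : Measurable G) (hG0 : ∀ ω, 0 ≤ G ω) (hG1 : ∀ ω, G ω ≤ 1) (hGpos : ∀ᵐ ω ∂P, 0 < G ω) :
    ∃ Q : Measure Ω, EquivProb P Q ∧ ∃ q : ℝ, ∀ f : Ω → ℝ, Integrable f P →
      ∫⁻ ω, ENNReal.ofReal |f ω| ∂Q = ENNReal.ofReal ((∫ ω, G ω * |f ω| ∂P) / q) := by
  have hGb : ∀ᵐ ω ∂P, ‖G ω‖ ≤ 1 := ae_of_all _ fun ω => by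
    rw [Real.norm_of_nonneg (hG0 ω)]; exact hG1 ω
  have hGint : Integrable G P := Integrable.of_bound hGm.aestronglyMeasurable 1 hGb
  set q := ∫ ω, G ω ∂P with hq
  have hqpos : 0 < q := by
    refine (integral_pos_iff_support_of_nonneg hG0 hGint).2 ?_
    have : P (Function.support G) = 1 := by
      rw [prob_compl_eq_zero_iff₀ _ |>.symm]
      · refine measure_mono_null (fun ω hω => ?_) hGpos
        simp only [mem_compl_iff, Function.mem_support, not_not] at hω
        simp [hω]
      · exact (measurableSet_support hGm).nullMeasurableSet
    simp [this]
  have hm : Measurable fun ω => ENNReal.ofReal (G ω / q) := by fun_prop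
  have key (f : Ω → ℝ) (hf : Integrable f P) :
      ∫⁻ ω, ENNReal.ofReal |f ω| ∂(P.withDensity fun ω => ENNReal.ofReal (G ω / q))
        = ENNReal.ofReal ((∫ ω, G ω * |f ω| ∂P) / q) := by
    rw [lintegral_withDensity_eq_lintegral_mul₀ hm.aemeasurable (by fun_prop),
      ← integral_div, ofReal_integral_eq_lintegral_ofReal
        ((hf.abs.bdd_mul hGm.aestronglyMeasurable hGb).div_const q)
        (ae_of_all _ fun ω => div_nonneg (mul_nonneg (hG0 ω) (abs_nonneg _)) hqpos.le)]
    refine lintegral_congr fun ω => ?_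
    rw [Pi.mul_apply, ← ENNReal.ofReal_mul (div_nonneg (hG0 ω) hqpos.le)]
    congr 1
    ring
  refine ⟨_, ⟨⟨?_⟩, withDensity_absolutelyContinuous P _,
    withDensity_absolutelyContinuous' hm.aemeasurable ?_⟩, q, key⟩
  · have := key (fun _ => 1) (integrable_const 1)
    simpa [← hq, div_self hqpos.ne'] using this
  · filter_upwards [hGpos] with ω h
    exact (ENNReal.ofReal_pos.2 (div_pos h hqpos)).ne'

/-- A single density discounts the countably many families of differences `|Z - X|`, `X ∈ S`, so
that convergence in probability to points of `S` becomes weighted `L¹`-convergence. -/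
theorem exists_density_of_locConvexAt (P : Measure Ω) [IsProbabilityMeasure P]
    {K S : Set (Ω → ℝ)} (hK : Convex ℝ K) (hbdd : BddL1 P K) (hpos : ∀ X ∈ K, 0 ≤ᵐ[P] X)
    (hSK : S ⊆ K) (hS : S.Countable) (hloc : ∀ X ∈ S, LocConvexAt P K X) :
    ∃ G : Ω → ℝ, Measurable G ∧ (∀ ω, 0 ≤ G ω) ∧ (∀ ω, G ω ≤ 1) ∧ (∀ᵐ ω ∂P, 0 < G ω) ∧
      ∀ X ∈ S, ∀ Zs : ℕ → Ω → ℝ, (∀ n, Zs n ∈ K) → TendstoInMeasure P Zs atTop X →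
        Tendsto (fun n => ∫ ω, G ω * |Zs n ω - X ω| ∂P) atTop (nhds 0) := by
  obtain ⟨hint, C, hC⟩ := hbdd
  rcases S.eq_empty_or_nonempty with rfl | hne
  · exact ⟨fun _ => 1, measurable_const, fun _ => zero_le_one, fun _ => le_rfl,
      ae_of_all _ fun _ => one_pos, by simp⟩
  obtain ⟨s, rfl⟩ := hS.exists_eq_range hne
  have hsK (j : ℕ) : s j ∈ K := hSK (mem_range_self j)
  choose δ hδ hsmall using fun n : ℕ => exists_pos_integral_min_convexHull_le hK hint hpos
    (hsK n.unpair.1) (hloc _ (mem_range_self _)) (show (0 : ℝ) < (1 / 2) ^ n by positivity)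
  have hsub (n : ℕ) : convexHull ℝ ((fun Z : Ω → ℝ => fun ω => |Z ω - s n.unpair.1 ω|) ''
      {Z | Z ∈ K ∧ probDist P Z (s n.unpair.1) < δ n}) ⊆ {V | Integrable V P ∧ 0 ≤ᵐ[P] V} := by
    refine convexHull_min ?_ ?_
    · rintro _ ⟨Z, hZ, rfl⟩
      exact ⟨((hint _ hZ.1).sub (hint _ (hsK _))).abs, ae_of_all _ fun ω => abs_nonneg _⟩
    · rintro U ⟨hU, hU0⟩ V ⟨hV, hV0⟩ a b ha hb -
      refine ⟨(hU.smul a).add (hV.smul b), ?_⟩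
      filter_upwards [hU0, hV0] with ω h1 h2
      exact add_nonneg (mul_nonneg ha h1) (mul_nonneg hb h2)
  choose g hgm hg0 hg1 hgsq hgV using fun n : ℕ => exists_density_of_convex P
    (convex_convexHull ℝ _)
    (convexHull_nonempty_iff.2
      (Set.Nonempty.image _ (s := {Z | Z ∈ K ∧ probDist P Z (s n.unpair.1) < δ n})
        ⟨s n.unpair.1, hsK _, by simpa [probDist] using hδ n⟩))
    (fun V hV => (hsub n hV).1) (fun V hV => (hsub n hV).2) (hsmall n)
  obtain ⟨G, hGm, hG0, hG1, hGpos, hGg⟩ := exists_pos_le_add_pow P hgm hg0 hg1 hgsq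
  refine ⟨G, hGm, hG0, hG1, hGpos, ?_⟩
  rintro _ ⟨j, rfl⟩ Zs hZs hlim
  rw [tendstoInMeasure_iff_tendsto_probDist (fun n => (hint _ (hZs n)).aestronglyMeasurable)
    (hint _ (hsK j)).aestronglyMeasurable] at hlim
  refine tendsto_order.2 ⟨fun a ha => Eventually.of_forall fun n => ha.trans_le
    (integral_nonneg fun ω => mul_nonneg (hG0 ω) (abs_nonneg _)), fun η hη => ?_⟩
  have hpow : Tendsto (fun m : ℕ => (1 / 2 : ℝ) ^ Nat.pair j m * (1 + 2 * C)) atTop (nhds 0) := by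
    have hpair : Tendsto (fun m => Nat.pair j m) atTop atTop :=
      tendsto_atTop_mono (fun m => Nat.right_le_pair j m) tendsto_id
    simpa using ((tendsto_pow_atTop_nhds_zero_of_lt_one (show (0 : ℝ) ≤ 1 / 2 by norm_num)
      (by norm_num)).comp hpair).mul_const (1 + 2 * C)
  obtain ⟨m, hm⟩ := (hpow.eventually_lt_const hη).exists
  have hj : (Nat.pair j m).unpair.1 = j := by simp
  filter_upwards [hlim.eventually_lt_const (hδ (Nat.pair j m))] with n hn
  have hdiff : Integrable (fun ω => |Zs n ω - s j ω|) P :=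
    ((hint _ (hZs n)).sub (hint _ (hsK j))).abs
  have hV := hgV (Nat.pair j m) (fun ω => |Zs n ω - s j ω|)
    (subset_convexHull ℝ _ ⟨Zs n, ⟨hZs n, by rwa [hj]⟩, by rw [hj]⟩)
  have hdiffC : ∫ ω, |Zs n ω - s j ω| ∂P ≤ 2 * C := by
    calc ∫ ω, |Zs n ω - s j ω| ∂P ≤ ∫ ω, (|Zs n ω| + |s j ω|) ∂P :=
          integral_mono hdiff ((hint _ (hZs n)).abs.add (hint _ (hsK j)).abs)
            fun ω => abs_sub _ _
      _ ≤ 2 * C := by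
          rw [integral_add (hint _ (hZs n)).abs (hint _ (hsK j)).abs]
          linarith [hC _ (hZs n), hC _ (hsK j)]
  have hgint : Integrable (fun ω => g (Nat.pair j m) ω * |Zs n ω - s j ω|) P :=
    hdiff.bdd_mul (c := 1) (hgm _).aestronglyMeasurable (ae_of_all _ fun ω => by
      rw [Real.norm_of_nonneg (hg0 _ ω)]; exact hg1 _ ω)
  calc ∫ ω, G ω * |Zs n ω - s j ω| ∂P
      ≤ ∫ ω, (g (Nat.pair j m) ω * |Zs n ω - s j ω|
          + (1 / 2) ^ Nat.pair j m * |Zs n ω - s j ω|) ∂P := by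
        refine integral_mono_of_nonneg
          (ae_of_all _ fun ω => mul_nonneg (hG0 ω) (abs_nonneg _))
          (hgint.add (hdiff.const_mul _)) (ae_of_all _ fun ω => ?_)
        change G ω * |Zs n ω - s j ω| ≤
          g (Nat.pair j m) ω * |Zs n ω - s j ω| + (1 / 2) ^ Nat.pair j m * |Zs n ω - s j ω|
        rw [← add_mul]
        exact mul_le_mul_of_nonneg_right (hGg _ ω) (abs_nonneg _)
    _ ≤ (1 / 2) ^ Nat.pair j m + (1 / 2) ^ Nat.pair j m * (2 * C) := by
        rw [integral_add hgint (hdiff.const_mul _), integral_const_mul]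
        gcongr
    _ < η := by linarith

theorem locConvexAt_of_topAgree {P Q : Measure Ω} {K : Set (Ω → ℝ)} (hK : Convex ℝ K)
    (hmeas : ∀ Z ∈ K, AEMeasurable Z P) (hQP : Q ≪ P) (hagree : TopAgree P Q K)
    {X : Ω → ℝ} (hX : X ∈ K) : LocConvexAt P K X := by
  intro Xs hXs hlim W hW
  have hWK (k : ℕ) : W k ∈ K :=
    convexHull_min (image_subset_iff.2 fun n _ => hXs n) hK (hW k)
  rw [hagree W X hWK hX]
  rw [hagree Xs X hXs hX] at hlim
  have hconv (c : ENNReal) : Convex ℝ {Z : Ω → ℝ | AEMeasurable Z Q ∧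
      ∫⁻ ω, ENNReal.ofReal |Z ω - X ω| ∂Q ≤ c} := by
    rintro Y ⟨hYm, hY⟩ Z ⟨hZm, hZ⟩ a b ha hb hab
    have hXm : AEMeasurable X Q := (hmeas X hX).mono_ac hQP
    refine ⟨(hYm.const_smul a).add (hZm.const_smul b), ?_⟩
    calc ∫⁻ ω, ENNReal.ofReal |(a • Y + b • Z) ω - X ω| ∂Q
        ≤ ∫⁻ ω, (ENNReal.ofReal a * ENNReal.ofReal |Y ω - X ω|
            + ENNReal.ofReal b * ENNReal.ofReal |Z ω - X ω|) ∂Q := by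
          refine lintegral_mono fun ω => ?_
          rw [← ENNReal.ofReal_mul ha, ← ENNReal.ofReal_mul hb,
            ← ENNReal.ofReal_add (mul_nonneg ha (abs_nonneg _)) (mul_nonneg hb (abs_nonneg _))]
          refine ENNReal.ofReal_le_ofReal ?_
          have hid : (a • Y + b • Z) ω - X ω = a * (Y ω - X ω) + b * (Z ω - X ω) := by
            simp only [Pi.add_apply, Pi.smul_apply, smul_eq_mul]
            linear_combination X ω * hab
          rw [hid]
          refine (abs_add_le _ _).trans_eq ?_
          rw [abs_mul, abs_mul, abs_of_nonneg ha, abs_of_nonneg hb]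
      _ = ENNReal.ofReal a * ∫⁻ ω, ENNReal.ofReal |Y ω - X ω| ∂Q
            + ENNReal.ofReal b * ∫⁻ ω, ENNReal.ofReal |Z ω - X ω| ∂Q := by
          rw [lintegral_add_left' (by fun_prop), lintegral_const_mul'' _ (by fun_prop),
            lintegral_const_mul'' _ (by fun_prop)]
      _ ≤ ENNReal.ofReal a * c + ENNReal.ofReal b * c := by gcongr
      _ = c := by rw [← add_mul, ← ENNReal.ofReal_add ha hb, hab, ENNReal.ofReal_one, one_mul]
  rw [ENNReal.tendsto_atTop_zero] at hlim ⊢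
  intro ε hε
  obtain ⟨N, hN⟩ := hlim ε hε
  refine ⟨N, fun k hk => (convexHull_min ?_ (hconv ε) (hW k)).2⟩
  rintro _ ⟨n, hn, rfl⟩
  exact ⟨(hmeas _ (hXs n)).mono_ac hQP, hN n (hk.trans hn)⟩

/-- Theorem 3.7: if the convex `L¹(P)`-bounded set `K` of nonnegative random variables contains
a countable relatively internal subset `S`, then local convexity of the `L⁰(P)`-topology on `K`
is equivalent to the existence of an equivalent `Q` for which the `L⁰(Q)`- and
`L¹(Q)`-topologies agree on `K`. -/
theorem statement9 (P : Measure Ω) [IsProbabilityMeasure P]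
    (K S : Set (Ω → ℝ)) (hKconv : Convex ℝ K) (hKbdd : BddL1 P K)
    (hKpos : ∀ X ∈ K, (0 : Ω → ℝ) ≤ᵐ[P] X)
    (hSsub : S ⊆ K) (hScount : S.Countable)
    (hSinternal : ∀ X ∈ K, ∃ Y ∈ S, ∃ t : ℝ, 0 < t ∧ Y + t • (Y - X) ∈ K) :
    (∀ X ∈ K, LocConvexAt P K X) ↔
      (∃ Q : Measure Ω, EquivProb P Q ∧ TopAgree P Q K) := by
  constructor
  · intro hloc
    obtain ⟨G, hGm, hG0, hG1, hGpos, hG⟩ := exists_density_of_locConvexAt P hKconv hKbdd hKpos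
      hSsub hScount fun X hX => hloc X (hSsub hX)
    obtain ⟨Q, hQ, q, hq⟩ := exists_equivProb_lintegral_eq P hGm hG0 hG1 hGpos
    have hint := hKbdd.1
    refine ⟨Q, hQ, fun Xs X hXs hX => ⟨fun hlim => ?_, tendstoInMeasure_of_tendsto_lintegral_abs
      hQ (fun n => (hint _ (hXs n)).aestronglyMeasurable) (hint X hX).aestronglyMeasurable⟩⟩
    obtain ⟨Y, hY, t, ht, hU⟩ := hSinternal X hX
    set U := Y + t • (Y - X) with hUdef
    -- `Y` is an interior point of the segment from `X` to `U`; contract `K` towards `U`.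
    let Zs (n : ℕ) : Ω → ℝ := (1 / (1 + t)) • U + (t / (1 + t)) • Xs n
    have ht1 : 0 < 1 + t := by linarith
    have hZs (n : ℕ) : Zs n ∈ K := hKconv hU (hXs n) (by positivity) (by positivity)
      (by field_simp)
    have hdiff (n : ℕ) (ω : Ω) : Zs n ω - Y ω = t / (1 + t) * (Xs n ω - X ω) := by
      simp only [Zs, hUdef, Pi.add_apply, Pi.smul_apply, Pi.sub_apply, smul_eq_mul]
      field_simp
      ring
    have htt : t / (1 + t) ≤ 1 := (div_le_one ht1).2 (by linarith)
    have hZlim : TendstoInMeasure P Zs atTop Y := by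
      rw [tendstoInMeasure_iff_norm] at hlim ⊢
      intro ε hε
      refine tendsto_of_tendsto_of_tendsto_of_le_of_le tendsto_const_nhds (hlim ε hε)
        (fun n => zero_le) fun n => measure_mono fun ω hω => ?_
      simp only [mem_ofPred_eq, hdiff, norm_mul] at hω ⊢
      rw [Real.norm_of_nonneg (by positivity)] at hω
      exact hω.trans (mul_le_of_le_one_left (norm_nonneg _) htt)
    have hL := ((hG Y hY Zs hZs hZlim).div_const (t / (1 + t))).div_const q
    have heq (n : ℕ) : ∫⁻ ω, ENNReal.ofReal |Xs n ω - X ω| ∂Q = ENNReal.ofReal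
        ((∫ ω, G ω * |Zs n ω - Y ω| ∂P) / (t / (1 + t)) / q) := by
      have h : ∫ ω, G ω * |(Xs n - X) ω| ∂P =
          (∫ ω, G ω * |Zs n ω - Y ω| ∂P) / (t / (1 + t)) := by
        rw [← integral_div]
        refine integral_congr_ae (ae_of_all _ fun ω => ?_)
        dsimp only
        rw [hdiff, abs_mul, abs_of_pos (div_pos ht ht1), Pi.sub_apply]
        field_simp
      rw [← h]
      exact hq _ ((hint _ (hXs n)).sub (hint X hX))
    simp only [heq]
    simpa using ENNReal.tendsto_ofReal hL
  · rintro ⟨Q, ⟨-, hQP, -⟩, hagree⟩ X hX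
    exact locConvexAt_of_topAgree hKconv (fun Z hZ => (hKbdd.1 Z hZ).aemeasurable) hQP hagree hX

end Paper
end
end

section
/- Let (Ω,Σ,P) be a probability space and let (R_k)_{k≥1} be a sequence of P-integrable random variables with sup_k E_P[|R_k|] < ∞, such that for every sequence (V_m) with V_m in the convex hull of {R_k : k ≥ m} ∪ {−R_k : k ≥ m}, (V_m) converges to 0 in P-probability. Let L = { Σ_{k=1}^∞ a_k R_k : Σ_{k=1}^∞ |a_k| ≤ 1 }, where the series converges in L^1(P). Then for every m ∈ ℕ there exists n ∈ ℕ such that every G ∈ L with d(G,0) < 1/n can be written as G = H + J where E_P[|H|] ≤ 1/m and J lies in the convex hull of {R_k : k ≥ m+1} ∪ {−R_k : k ≥ m+1}. -/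
open MeasureTheory Filter Set ProbabilityTheory

noncomputable section

namespace Paper

variable {Ω : Type*} [MeasurableSpace Ω]

section Helpers

open scoped Pointwise

/-- The convex hull of `±R j`, `j ≥ N`. -/
def tailHull {E : Type*} [AddCommGroup E] [Module ℝ E] (R : ℕ → E) (N : ℕ) : Set E :=
  convexHull ℝ ((R '' {j | N ≤ j}) ∪ ((fun j => -R j) '' {j | N ≤ j}))

lemma tailHull_anti {E : Type*} [AddCommGroup E] [Module ℝ E] (R : ℕ → E) {N M : ℕ} (h : N ≤ M) :
    tailHull R M ⊆ tailHull R N :=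
  convexHull_mono (union_subset_union (image_mono fun _ hj => le_trans h hj)
    (image_mono fun _ hj => le_trans h hj))

lemma zero_mem_tailHull {E : Type*} [AddCommGroup E] [Module ℝ E] (R : ℕ → E) (N : ℕ) :
    (0 : E) ∈ tailHull R N := by
  have h1 : R N ∈ tailHull R N := subset_convexHull _ _ (Or.inl ⟨N, le_refl N, rfl⟩)
  have h2 : -R N ∈ tailHull R N := subset_convexHull _ _ (Or.inr ⟨N, le_refl N, rfl⟩)
  have := (convex_convexHull ℝ _) h1 h2 (a := 1 / 2) (b := 1 / 2) (by norm_num) (by norm_num)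
    (by norm_num)
  simpa [tailHull] using this

lemma sum_smul_mem_tailHull {E : Type*} [AddCommGroup E] [Module ℝ E] (R : ℕ → E)
    (N : ℕ) (a : ℕ → ℝ) (t : Finset ℕ) (ht : ∀ k ∈ t, N ≤ k) (ha : ∑ k ∈ t, |a k| ≤ 1) :
    ∑ k ∈ t, a k • R k ∈ tailHull R N := by
  have hconv : Convex ℝ (tailHull R N) := convex_convexHull ℝ _
  have key : ∀ u ⊆ t, ∑ k ∈ u, a k • R k ∈ (∑ k ∈ u, |a k|) • tailHull R N := by
    intro u
    induction u using Finset.induction_on with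
    | empty => intro _; exact ⟨0, zero_mem_tailHull R N, by simp⟩
    | insert i u hi ih =>
      intro hu
      rw [Finset.sum_insert hi, Finset.sum_insert hi,
        hconv.add_smul (abs_nonneg _) (Finset.sum_nonneg fun _ _ => abs_nonneg _)]
      refine Set.add_mem_add ?_ (ih fun x hx => hu (Finset.mem_insert_of_mem hx))
      have hN : N ≤ i := ht i (hu (Finset.mem_insert_self i u))
      rcases le_total 0 (a i) with h | h
      · exact ⟨R i, subset_convexHull _ _ (Or.inl ⟨i, hN, rfl⟩), by simp [abs_of_nonneg h]⟩
      · exact ⟨-R i, subset_convexHull _ _ (Or.inr ⟨i, hN, rfl⟩), by simp [abs_of_nonpos h]⟩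
  obtain ⟨x, hx, hxe⟩ := key t subset_rfl
  simp only at hxe
  rw [← hxe]
  exact hconv.smul_mem_of_zero_mem (zero_mem_tailHull R N) hx
    ⟨Finset.sum_nonneg fun _ _ => abs_nonneg _, ha⟩

lemma integrable_of_mem_tailHull {P : Measure Ω} {R : ℕ → Ω → ℝ} (hint : ∀ j, Integrable (R j) P)
    {N : ℕ} {V : Ω → ℝ} (hV : V ∈ tailHull R N) : Integrable V P := by
  have hconv : Convex ℝ {X : Ω → ℝ | Integrable X P} :=
    fun X hX Y hY a b _ _ _ => (Integrable.smul a hX).add (Integrable.smul b hY)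
  refine convexHull_min ?_ hconv hV
  rintro _ (⟨j, _, rfl⟩ | ⟨j, _, rfl⟩)
  · exact hint j
  · exact (hint j).neg

lemma integrable_min_abs {P : Measure Ω} {X : Ω → ℝ} (hX : Integrable X P) :
    Integrable (fun ω => min |X ω| 1) P := by
  refine hX.mono (hX.1.norm.aemeasurable.min aemeasurable_const).aestronglyMeasurable
    (ae_of_all _ fun ω => ?_)
  rw [Real.norm_of_nonneg (le_min (abs_nonneg _) zero_le_one)]
  exact min_le_left _ _

lemma probDist_zero_le_add_measureReal {P : Measure Ω} [IsProbabilityMeasure P] {X : Ω → ℝ}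
    (hX : Integrable X P) {δ : ℝ} (hδ : 0 ≤ δ) :
    probDist P X 0 ≤ δ + P.real {ω | δ ≤ ‖X ω - 0‖} := by
  have hm : NullMeasurableSet {ω | δ ≤ ‖X ω - 0‖} P :=
    nullMeasurableSet_le aemeasurable_const (by simpa using hX.1.norm.aemeasurable)
  have hi : Integrable ({ω | δ ≤ ‖X ω - 0‖}.indicator fun _ => (1 : ℝ)) P :=
    (integrable_const 1).indicator₀ hm
  calc probDist P X 0 = ∫ ω, min |X ω| 1 ∂P := by simp [probDist]
    _ ≤ ∫ ω, (δ + {ω | δ ≤ ‖X ω - 0‖}.indicator (fun _ => (1 : ℝ)) ω) ∂P := by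
        refine integral_mono (integrable_min_abs hX) ((integrable_const δ).add hi) fun ω => ?_
        by_cases h : δ ≤ ‖X ω - 0‖
        · simp only [indicator, mem_ofPred_eq, h, if_true]
          linarith [min_le_right |X ω| 1]
        · simp only [indicator, mem_ofPred_eq, h, if_false]
          have : |X ω| < δ := by simpa using h
          linarith [min_le_left |X ω| 1]
    _ = δ + P.real {ω | δ ≤ ‖X ω - 0‖} := by
        rw [integral_add (integrable_const δ) hi, integral_indicator₀ hm]
        simp

lemma exists_tailHull_probDist_le {P : Measure Ω} [IsProbabilityMeasure P] {R : ℕ → Ω → ℝ}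
    (hint : ∀ j, Integrable (R j) P)
    (hfcc : ∀ V : ℕ → Ω → ℝ, (∀ m, V m ∈ tailHull R m) →
      TendstoInMeasure P V atTop (fun _ => (0 : ℝ))) {ε : ℝ} (hε : 0 < ε) :
    ∃ N, ∀ V ∈ tailHull R N, probDist P V 0 ≤ ε := by
  by_contra! hcon
  choose V hV hVε using hcon
  have h := tendstoInMeasure_iff_measureReal_norm.1 (hfcc V hV) (ε / 2) (by positivity)
  obtain ⟨n, hn⟩ := (h.eventually (gt_mem_nhds (half_pos hε))).exists
  have := probDist_zero_le_add_measureReal (integrable_of_mem_tailHull hint (hV n))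
    (half_pos hε).le
  linarith [hVε n]

lemma probDist_zero_le_add {P : Measure Ω} {X Y Z : Ω → ℝ} (hX : Integrable X P)
    (hY : Integrable Y P) (hZ : Integrable Z P) (h : ∀ ω, |X ω| ≤ |Y ω| + |Z ω|) :
    probDist P X 0 ≤ probDist P Y 0 + probDist P Z 0 := by
  simp only [probDist, Pi.zero_apply, sub_zero]
  rw [← integral_add (integrable_min_abs hY) (integrable_min_abs hZ)]
  refine integral_mono (integrable_min_abs hX)
    ((integrable_min_abs hY).add (integrable_min_abs hZ)) fun ω => ?_
  have h0 := h ω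
  have := abs_nonneg (Y ω)
  have := abs_nonneg (Z ω)
  simp only
  rcases le_total |Y ω| 1 with hy | hy <;> rcases le_total |Z ω| 1 with hz | hz <;>
    rcases le_total |X ω| 1 with hx | hx <;> simp [hx, hy, hz] <;> linarith

lemma probDist_zero_le_integral_abs {P : Measure Ω} {X : Ω → ℝ} (hX : Integrable X P) :
    probDist P X 0 ≤ ∫ ω, |X ω| ∂P := by
  simp only [probDist, Pi.zero_apply, sub_zero]
  exact integral_mono (integrable_min_abs hX) hX.abs fun ω => min_le_left _ _

lemma ae_eq_zero_of_probDist_zero_le {P : Measure Ω} {X : Ω → ℝ} (hX : Integrable X P)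
    (h : probDist P X 0 ≤ 0) : X =ᵐ[P] 0 := by
  simp only [probDist, Pi.zero_apply, sub_zero] at h
  have hnn : 0 ≤ fun ω => min |X ω| 1 := fun ω => le_min (abs_nonneg _) zero_le_one
  have h0 := (integral_eq_zero_iff_of_nonneg hnn (integrable_min_abs hX)).1
    (le_antisymm h (integral_nonneg hnn))
  filter_upwards [h0] with ω hω
  have hω' : min |X ω| 1 = 0 := hω
  rcases min_choice |X ω| 1 with h1 | h1
  · exact abs_eq_zero.1 (h1 ▸ hω')
  · rw [h1] at hω'; norm_num at hω'

lemma tsum_lintegral_enorm_le {P : Measure Ω} {R : ℕ → Ω → ℝ} (hint : ∀ j, Integrable (R j) P)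
    {C : ℝ} (hC : ∀ j, (∫ ω, |R j ω| ∂P) ≤ C) {b : ℕ → ℝ} (hb : Summable fun k => |b k|) :
    ∑' k, ∫⁻ ω, ‖b k * R k ω‖ₑ ∂P ≤ ENNReal.ofReal (C * ∑' k, |b k|) := by
  have hC0 : 0 ≤ C := (integral_nonneg fun _ => abs_nonneg _).trans (hC 0)
  rw [← tsum_mul_left, ENNReal.ofReal_tsum_of_nonneg (fun k => by positivity) (hb.mul_left C)]
  refine ENNReal.tsum_le_tsum fun k => ?_
  rw [← ofReal_integral_norm_eq_lintegral_enorm ((hint k).const_mul (b k))]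
  refine ENNReal.ofReal_le_ofReal ?_
  simp only [norm_mul, Real.norm_eq_abs, integral_const_mul]
  rw [mul_comm]
  exact mul_le_mul_of_nonneg_right (hC k) (abs_nonneg _)

lemma ae_summable_mul {P : Measure Ω} {R : ℕ → Ω → ℝ} (hint : ∀ j, Integrable (R j) P)
    {C : ℝ} (hC : ∀ j, (∫ ω, |R j ω| ∂P) ≤ C) {b : ℕ → ℝ} (hb : Summable fun k => |b k|) :
    ∀ᵐ ω ∂P, Summable fun k => b k * R k ω := by
  have := summable_norm_of_tsum_eLpNorm_ne_top (μ := P) le_rfl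
    (fun k => ((hint k).const_mul (b k)).1) (by
      simp only [eLpNorm_one_eq_lintegral_enorm]
      exact ((tsum_lintegral_enorm_le hint hC hb).trans_lt ENNReal.ofReal_lt_top).ne)
  filter_upwards [this] with ω hω using hω.of_norm

lemma integrable_tsum_mul {P : Measure Ω} {R : ℕ → Ω → ℝ} (hint : ∀ j, Integrable (R j) P)
    {C : ℝ} (hC : ∀ j, (∫ ω, |R j ω| ∂P) ≤ C) {b : ℕ → ℝ} (hb : Summable fun k => |b k|) :
    Integrable (fun ω => ∑' k, b k * R k ω) P ∧
      (∫ ω, |∑' k, b k * R k ω| ∂P) ≤ C * ∑' k, |b k| := by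
  have hC0 : 0 ≤ C := (integral_nonneg fun _ => abs_nonneg _).trans (hC 0)
  have hmeas : AEStronglyMeasurable (fun ω => ∑' k, b k * R k ω) P := by
    refine (aemeasurable_of_tendsto_metrizable_ae atTop
      (f := fun n ω => ∑ k ∈ Finset.range n, b k * R k ω) (fun n => ?_) ?_).aestronglyMeasurable
    · exact Finset.aemeasurable_fun_sum _ fun k _ => ((hint k).const_mul (b k)).1.aemeasurable
    · filter_upwards [ae_summable_mul hint hC hb] with ω hω using hω.hasSum.tendsto_sum_nat
  have hle : ∫⁻ ω, ‖∑' k, b k * R k ω‖ₑ ∂P ≤ ENNReal.ofReal (C * ∑' k, |b k|) := by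
    refine le_trans ?_ (tsum_lintegral_enorm_le hint hC hb)
    rw [← lintegral_tsum fun k => ((hint k).const_mul (b k)).1.enorm]
    exact lintegral_mono fun ω => enorm_tsum_le_tsum_enorm
  have hI : Integrable (fun ω => ∑' k, b k * R k ω) P :=
    ⟨hmeas, hle.trans_lt ENNReal.ofReal_lt_top⟩
  refine ⟨hI, ?_⟩
  rw [← ofReal_integral_norm_eq_lintegral_enorm hI] at hle
  exact (ENNReal.ofReal_le_ofReal_iff
    (mul_nonneg hC0 (tsum_nonneg fun _ => abs_nonneg _))).1 hle

lemma integral_abs_tsum_sub_le {P : Measure Ω} {R : ℕ → Ω → ℝ} (hint : ∀ j, Integrable (R j) P)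
    {C : ℝ} (hC : ∀ j, (∫ ω, |R j ω| ∂P) ≤ C) {a b : ℕ → ℝ} (ha : Summable fun k => |a k|)
    (hb : Summable fun k => |b k|) (N M : ℕ) :
    (∫ ω, |(∑' k, b k * R k ω) - (∑' k, a k * R k ω) -
        (∑ k ∈ Finset.Ico N M, b k • R k) ω| ∂P) ≤
      C * (∑ k ∈ Finset.range N, |b k - a k| + ∑' k, |a (k + N)| + ∑' k, |b (k + M)|) := by
  have hC0 : 0 ≤ C := (integral_nonneg fun _ => abs_nonneg _).trans (hC 0)
  set c : ℕ → ℝ := fun k => if k ∈ Finset.Ico N M then b k else 0 with hc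
  set u : ℕ → ℝ := fun k => if M ≤ k then |b k| else 0 with hu
  have hu0 : ∀ k, 0 ≤ u k := fun k => by simp only [hu]; split_ifs <;> positivity
  have hub : ∀ k, u k ≤ |b k| := fun k => by
    simp only [hu]; split_ifs; exacts [le_rfl, abs_nonneg _]
  have hus : Summable u := hb.of_nonneg_of_le hu0 hub
  have hcb : ∀ k, |c k| ≤ |b k| := fun k => by
    simp only [hc]; split_ifs; exacts [le_rfl, by simp]
  have hcs : Summable fun k => |c k| := hb.of_nonneg_of_le (fun _ => abs_nonneg _) hcb
  have he : Summable fun k => |b k - a k - c k| :=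
    ((hb.of_abs.sub ha.of_abs).sub hcs.of_abs).abs
  have heq : (fun ω => |(∑' k, b k * R k ω) - (∑' k, a k * R k ω) -
        (∑ k ∈ Finset.Ico N M, b k • R k) ω|) =ᵐ[P]
      fun ω => |∑' k, (b k - a k - c k) * R k ω| := by
    filter_upwards [ae_summable_mul hint hC ha, ae_summable_mul hint hC hb,
      ae_summable_mul hint hC hcs] with ω h1 h2 h3
    have h4 : ∑' k, c k * R k ω = (∑ k ∈ Finset.Ico N M, b k • R k) ω := by
      rw [tsum_eq_sum (s := Finset.Ico N M) fun k hk => by simp only [hc, if_neg hk, zero_mul],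
        Finset.sum_apply]
      exact Finset.sum_congr rfl fun k hk => by simp only [hc, if_pos hk, Pi.smul_apply, smul_eq_mul]
    rw [← h4, ← h2.tsum_sub h1, ← (h2.sub h1).tsum_sub h3]
    simp only [sub_mul]
  rw [integral_congr_ae heq]
  refine (integrable_tsum_mul hint hC he).2.trans (mul_le_mul_of_nonneg_left ?_ hC0)
  rw [← he.sum_add_tsum_nat_add N, add_assoc]
  have hhead : ∑ k ∈ Finset.range N, |b k - a k - c k| = ∑ k ∈ Finset.range N, |b k - a k| := by
    refine Finset.sum_congr rfl fun k hk => ?_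
    have : k ∉ Finset.Ico N M := by
      simp only [Finset.mem_range, Finset.mem_Ico] at *; omega
    simp only [hc, if_neg this, sub_zero]
  have haN : Summable fun k => |a (k + N)| := (summable_nat_add_iff N).2 ha
  have huN : Summable fun k => u (k + N) := (summable_nat_add_iff N).2 hus
  have htail : ∑' k, |b (k + N) - a (k + N) - c (k + N)| ≤
      ∑' k, |a (k + N)| + ∑' k, u (k + N) := by
    rw [← haN.tsum_add huN]
    refine ((summable_nat_add_iff N).2 he).tsum_le_tsum (fun k => ?_) (haN.add huN)
    by_cases hk : M ≤ k + N
    · have : k + N ∉ Finset.Ico N M := by simp only [Finset.mem_Ico]; omega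
      simp only [hc, hu, if_neg this, if_pos hk, sub_zero]
      exact (abs_sub _ _).trans_eq (add_comm _ _)
    · have : k + N ∈ Finset.Ico N M := by simp only [Finset.mem_Ico]; omega
      simp only [hc, hu, if_pos this, if_neg hk]
      rw [sub_right_comm, sub_self, zero_sub, abs_neg, add_zero]
  have huM : ∑' k, u (k + N) ≤ ∑' k, |b (k + M)| := by
    have h1 := hus.sum_add_tsum_nat_add N
    have h2 := hus.sum_add_tsum_nat_add M
    have h3 : ∑ k ∈ Finset.range M, u k = 0 := Finset.sum_eq_zero fun k hk => by
      have : ¬ M ≤ k := by simpa using hk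
      simp only [hu, if_neg this]
    have h4 : ∑' k, u (k + M) = ∑' k, |b (k + M)| := tsum_congr fun k => by simp [hu]
    have h5 := Finset.sum_nonneg (s := Finset.range N) fun k _ => hu0 k
    linarith
  linarith

lemma exists_tailHull_approx {P : Measure Ω} {R : ℕ → Ω → ℝ} (hint : ∀ j, Integrable (R j) P)
    {C : ℝ} (hC : ∀ j, (∫ ω, |R j ω| ∂P) ≤ C) {a : ℕ → ℝ} {b : ℕ → ℕ → ℝ}
    (ha : Summable fun k => |a k|) (hb : ∀ n, Summable fun k => |b n k|)
    (hb1 : ∀ n, ∑' k, |b n k| ≤ 1) (hlim : Tendsto b atTop (nhds a))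
    {ε : ℝ} (hε : 0 < ε) (N₀ : ℕ) :
    ∃ n ≥ N₀, ∃ J ∈ tailHull R N₀,
      (∫ ω, |(∑' k, b n k * R k ω) - (∑' k, a k * R k ω) - J ω| ∂P) ≤ ε := by
  have hC0 : 0 ≤ C := (integral_nonneg fun _ => abs_nonneg _).trans (hC 0)
  set δ := ε / (3 * (C + 1)) with hδ
  have hδ0 : 0 < δ := by positivity
  obtain ⟨N, hN, hNN₀⟩ := (((tendsto_sum_nat_add fun k => |a k|).eventually
    (gt_mem_nhds hδ0)).and (eventually_ge_atTop N₀)).exists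
  have hhead : Tendsto (fun n => ∑ k ∈ Finset.range N, |b n k - a k|) atTop (nhds 0) := by
    have : Tendsto (fun n => ∑ k ∈ Finset.range N, |b n k - a k|) atTop
        (nhds (∑ k ∈ Finset.range N, |a k - a k|)) :=
      tendsto_finsetSum _ fun k _ => ((tendsto_pi_nhds.1 hlim k).sub_const (a k)).abs
    simpa using this
  obtain ⟨n, hn, hnN₀⟩ := ((hhead.eventually (gt_mem_nhds hδ0)).and
    (eventually_ge_atTop N₀)).exists
  obtain ⟨M, hM⟩ := ((tendsto_sum_nat_add fun k => |b n k|).eventually (gt_mem_nhds hδ0)).exists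
  refine ⟨n, hnN₀, ∑ k ∈ Finset.Ico N M, b n k • R k, ?_, ?_⟩
  · refine sum_smul_mem_tailHull R N₀ _ _
      (fun k hk => hNN₀.trans (Finset.mem_Ico.1 hk).1) ?_
    exact ((hb n).sum_le_tsum _ fun _ _ => abs_nonneg _).trans (hb1 n)
  · refine (integral_abs_tsum_sub_le hint hC ha (hb n) N M).trans ?_
    calc C * (∑ k ∈ Finset.range N, |b n k - a k| + ∑' k, |a (k + N)| + ∑' k, |b n (k + M)|)
        ≤ (C + 1) * (3 * δ) := by
          refine mul_le_mul (by linarith) (by linarith) ?_ (by linarith)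
          have h1 := Finset.sum_nonneg (s := Finset.range N) fun k _ => abs_nonneg (b n k - a k)
          have h2 : 0 ≤ ∑' k, |a (k + N)| := tsum_nonneg fun _ => abs_nonneg _
          have h3 : 0 ≤ ∑' k, |b n (k + M)| := tsum_nonneg fun _ => abs_nonneg _
          linarith
      _ = ε := by rw [hδ]; field_simp

lemma exists_subseq_tendsto_of_tsum_abs_le_one {b : ℕ → ℕ → ℝ}
    (hb : ∀ n, Summable fun k => |b n k|) (hb1 : ∀ n, ∑' k, |b n k| ≤ 1) :
    ∃ a : ℕ → ℝ, (Summable fun k => |a k|) ∧ ∃ φ : ℕ → ℕ, StrictMono φ ∧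
      Tendsto (b ∘ φ) atTop (nhds a) := by
  have hK : IsCompact (Set.univ.pi fun _ : ℕ => Icc (-1 : ℝ) 1) :=
    isCompact_univ_pi fun _ => isCompact_Icc
  have hmem : ∀ n, b n ∈ Set.univ.pi fun _ : ℕ => Icc (-1 : ℝ) 1 := fun n k _ =>
    abs_le.1 (((hb n).le_tsum k fun _ _ => abs_nonneg _).trans (hb1 n))
  obtain ⟨a, -, φ, hφ, hlim⟩ := hK.tendsto_subseq hmem
  refine ⟨a, summable_of_sum_le (c := 1) (fun _ => abs_nonneg _) fun u => ?_, φ, hφ, hlim⟩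
  refine le_of_tendsto (tendsto_finsetSum u fun k _ => (tendsto_pi_nhds.1 hlim k).abs)
    (Eventually.of_forall fun n => ?_)
  exact ((hb _).sum_le_tsum _ fun _ _ => abs_nonneg _).trans (hb1 _)

end Helpers

/-- Lemma 4.6: decomposition of elements of `L` close to `0` in probability. -/
theorem statement13 (P : Measure Ω) [IsProbabilityMeasure P]
    (R : ℕ → Ω → ℝ) (hint : ∀ j, Integrable (R j) P)
    (hbdd : ∃ C : ℝ, ∀ j, (∫ ω, |R j ω| ∂P) ≤ C)
    (hfcc : ∀ V : ℕ → Ω → ℝ,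
      (∀ m, V m ∈ convexHull ℝ ((R '' {j | m ≤ j}) ∪ ((fun j => -R j) '' {j | m ≤ j}))) →
      TendstoInMeasure P V atTop (fun _ => (0 : ℝ))) :
    ∀ m : ℕ, 0 < m → ∃ n : ℕ, 0 < n ∧
      ∀ G ∈ Lset R, probDist P G (fun _ => (0 : ℝ)) < 1 / (n : ℝ) →
        ∃ H J : Ω → ℝ, G = H + J ∧ Integrable H P ∧ (∫ ω, |H ω| ∂P) ≤ 1 / (m : ℝ) ∧
          J ∈ convexHull ℝ
            ((R '' {j | m + 1 ≤ j}) ∪ ((fun j => -R j) '' {j | m + 1 ≤ j})) := by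
  intro m hm
  obtain ⟨C, hC⟩ := hbdd
  by_contra! hcon
  choose G hGL hG hGn using fun n : ℕ => hcon (n + 1) n.succ_pos
  choose b hb hb1 hGb using hGL
  obtain ⟨a, ha, φ, hφ, hlim⟩ := exists_subseq_tendsto_of_tsum_abs_le_one hb hb1
  have happrox : ∀ ε : ℝ, 0 < ε → ∀ N₀ : ℕ, ∃ n ≥ N₀, ∃ J ∈ tailHull R N₀,
      (∫ ω, |G (φ n) ω - (∑' k, a k * R k ω) - J ω| ∂P) ≤ ε := by
    intro ε hε N₀
    simp only [hGb]
    exact exists_tailHull_approx hint hC ha (fun n => hb (φ n)) (fun n => hb1 (φ n)) hlim hε N₀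
  have hSa := (integrable_tsum_mul hint hC ha).1
  have hGi : ∀ n, Integrable (G n) P := fun n => by
    rw [hGb n]
    exact (integrable_tsum_mul hint hC (hb n)).1
  have hzero : (fun ω => ∑' k, a k * R k ω) =ᵐ[P] 0 := by
    refine ae_eq_zero_of_probDist_zero_le hSa (le_of_forall_pos_le_add fun ε hε => ?_)
    obtain ⟨N₁, hN₁⟩ := exists_tailHull_probDist_le hint hfcc (ε := ε / 3) (by positivity)
    obtain ⟨N₂, hN₂⟩ := exists_nat_one_div_lt (show 0 < ε / 3 by positivity)
    obtain ⟨n, hn, J, hJ, hJε⟩ := happrox (ε / 3) (by positivity) (max N₁ N₂)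
    have hJi : Integrable J P := integrable_of_mem_tailHull hint hJ
    have hE := ((hGi (φ n)).sub hSa).sub hJi
    have h1 := hN₁ J (tailHull_anti R (le_max_left _ _) hJ)
    have h2 : probDist P (G (φ n)) 0 < ε / 3 := by
      refine lt_of_lt_of_le (hG (φ n)) (le_trans ?_ hN₂.le)
      have : (N₂ : ℝ) ≤ φ n := by
        exact_mod_cast (le_max_right _ _).trans (hn.trans (hφ.id_le n))
      push_cast
      exact one_div_le_one_div_of_le (by positivity) (by linarith)
    have h3 := probDist_zero_le_integral_abs hE
    have h4 := probDist_zero_le_add ((hGi (φ n)).sub hJi) (hGi (φ n)) hJi fun ω => abs_sub _ _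
    have h5 := probDist_zero_le_add hSa ((hGi (φ n)).sub hJi) hE fun ω => by
      refine le_trans (le_of_eq ?_) (abs_sub _ _)
      simp only [Pi.sub_apply]
      congr 1
      ring
    simp only [Pi.sub_apply] at h3
    linarith
  obtain ⟨n, -, J, hJ, hJε⟩ := happrox (1 / (m : ℝ)) (by positivity) (m + 1)
  have hJi : Integrable J P := integrable_of_mem_tailHull hint hJ
  refine hGn (φ n) (G (φ n) - J) J (sub_add_cancel _ _).symm ((hGi _).sub hJi) ?_ hJ
  refine le_of_eq_of_le (integral_congr_ae ?_) hJε
  filter_upwards [hzero] with ω hω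
  have hω' : ∑' k, a k * R k ω = 0 := hω
  simp only [Pi.sub_apply, hω', sub_zero]


end Paper
end
end
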